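/- arXiv:2206.01657 — 3 statements merged into one kernel-verified Lean document; each statement's English description precedes it below -/
import Mathlib

section
/- Let ς_1,…,ς_κ ∈ ℂ be such that K(ς_i) and K̂(ς_i) = Wᴴ K(ς_i) V are invertible for all i = 1,…,κ, and let c ∈ ℂ^p. Define recursively the matrices W_1 = K(ς_κ)^{-ᴴ} C(ς_κ)ᴴ c ∈ ℂ^{n×1} and W_i = K(ς_{κ-i+1})^{-ᴴ} Ñ(ς_{κ-i+1})ᴴ (I_m ⊗ W_{i-1}) ∈ ℂ^{n×m^{i-1}} for 2 ≤ i ≤ κ. If the columns of W_1,…,W_κ all lie in the column space of W, then for every 1 ≤ η ≤ κ the blockwise left tangential interpolation conditions cᴴ G_η(ς_{κ-η+1},…,ς_κ) = cᴴ Ĝ_η(ς_{κ-η+1},…,ς_κ) hold. -/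
open Matrix
open scoped Kronecker

namespace StructBilin

/-- Scaled sum of the bilinear terms: `𝔑(s, d) = ∑ i, d i • N i s`. -/
noncomputable def Nsum {n m : ℕ} (N : Fin m → ℂ → Matrix (Fin n) (Fin n) ℂ) (s : ℂ)
    (d : Fin m → ℂ) : Matrix (Fin n) (Fin n) ℂ :=
  ∑ i, d i • N i s

/-- Middle factor of the modified transfer function
`𝔾_{q+1}(σ 0, …, σ q | d 0, …, d (q-1)) = C (σ q) * gAux K B N σ d q`. -/
noncomputable def gAux {n m : ℕ} (K : ℂ → Matrix (Fin n) (Fin n) ℂ)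
    (B : ℂ → Matrix (Fin n) (Fin m) ℂ) (N : Fin m → ℂ → Matrix (Fin n) (Fin n) ℂ)
    (σ : ℕ → ℂ) (d : ℕ → Fin m → ℂ) : ℕ → Matrix (Fin n) (Fin m) ℂ
  | 0 => (K (σ 0))⁻¹ * B (σ 0)
  | j + 1 => (K (σ (j + 1)))⁻¹ * Nsum N (σ j) (d j) * gAux K B N σ d j

/-- The modified (scaled and summed) transfer function
`𝔾_{q+1}(σ 0, …, σ q | d 0, …, d (q-1))` (the level is `q + 1`, indices are 0-based). -/
noncomputable def Gmod {n m p : ℕ} (C : ℂ → Matrix (Fin p) (Fin n) ℂ)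
    (K : ℂ → Matrix (Fin n) (Fin n) ℂ) (B : ℂ → Matrix (Fin n) (Fin m) ℂ)
    (N : Fin m → ℂ → Matrix (Fin n) (Fin n) ℂ) (σ : ℕ → ℂ) (d : ℕ → Fin m → ℂ)
    (q : ℕ) : Matrix (Fin p) (Fin m) ℂ :=
  C (σ q) * gAux K B N σ d q

/-- Right tangential interpolation vectors:
`v 0 = K(σ 0)⁻¹ B(σ 0) b`, `v (j+1) = K(σ (j+1))⁻¹ 𝔑(σ j, d j) v j`. -/
noncomputable def vtan {n m : ℕ} (K : ℂ → Matrix (Fin n) (Fin n) ℂ)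
    (B : ℂ → Matrix (Fin n) (Fin m) ℂ) (N : Fin m → ℂ → Matrix (Fin n) (Fin n) ℂ)
    (σ : ℕ → ℂ) (d : ℕ → Fin m → ℂ) (b : Fin m → ℂ) : ℕ → Fin n → ℂ
  | 0 => (K (σ 0))⁻¹ *ᵥ (B (σ 0) *ᵥ b)
  | j + 1 => (K (σ (j + 1)))⁻¹ *ᵥ (Nsum N (σ j) (d j) *ᵥ vtan K B N σ d b j)

/-- Left tangential interpolation vectors (with reversed point sequence `τ` and
scaling sequence `e`):
`w 0 = K(τ 0)^{-ᴴ} C(τ 0)ᴴ c`, `w (t+1) = K(τ (t+1))^{-ᴴ} 𝔑(τ (t+1), e t)ᴴ w t`. -/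
noncomputable def wtan {n m p : ℕ} (C : ℂ → Matrix (Fin p) (Fin n) ℂ)
    (K : ℂ → Matrix (Fin n) (Fin n) ℂ) (N : Fin m → ℂ → Matrix (Fin n) (Fin n) ℂ)
    (τ : ℕ → ℂ) (e : ℕ → Fin m → ℂ) (c : Fin p → ℂ) : ℕ → Fin n → ℂ
  | 0 => ((K (τ 0))⁻¹)ᴴ *ᵥ ((C (τ 0))ᴴ *ᵥ c)
  | t + 1 => ((K (τ (t + 1)))⁻¹)ᴴ *ᵥ ((Nsum N (τ (t + 1)) (e t))ᴴ *ᵥ wtan C K N τ e c t)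

/-- Entrywise `t`-th complex derivative of a matrix-valued function. -/
noncomputable def mDeriv {α β : Type*} (t : ℕ) (f : ℂ → Matrix α β ℂ) (z : ℂ) :
    Matrix α β ℂ :=
  Matrix.of fun i j => iteratedDeriv t (fun w => f w i j) z

/-- Entrywise `t`-th complex derivative of a vector-valued function. -/
noncomputable def vDeriv {α : Type*} (t : ℕ) (f : ℂ → α → ℂ) (z : ℂ) : α → ℂ :=
  fun i => iteratedDeriv t (fun w => f w i) z

/-- Partial derivative in the `i`-th coordinate of a function of countably many
complex variables. -/
noncomputable def pD (i : ℕ) (f : (ℕ → ℂ) → ℂ) (s : ℕ → ℂ) : ℂ :=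
  deriv (fun z => f (Function.update s i z)) (s i)

/-- Mixed partial derivative `∂_{s_1^{ord 0} ⋯ s_t^{ord (t-1)}}` of a function of the
first `t` coordinates. -/
noncomputable def mixedD (ord : ℕ → ℕ) : ℕ → ((ℕ → ℂ) → ℂ) → (ℕ → ℂ) → ℂ
  | 0, f => f
  | t + 1, f => mixedD ord t ((pD t)^[ord t] f)

/-- The Hermite chain
`hChain t = ∂^{ℓ (t)}(𝔑(·, d t) K⁻¹)(σ t) ⋯ ∂^{ℓ 0}(𝔑(·, d 0) K⁻¹ B)(σ 0)`. -/
noncomputable def hChain {n m : ℕ} (K : ℂ → Matrix (Fin n) (Fin n) ℂ)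
    (B : ℂ → Matrix (Fin n) (Fin m) ℂ) (N : Fin m → ℂ → Matrix (Fin n) (Fin n) ℂ)
    (σ : ℕ → ℂ) (d : ℕ → Fin m → ℂ) (ℓ : ℕ → ℕ) : ℕ → Matrix (Fin n) (Fin m) ℂ
  | 0 => mDeriv (ℓ 0) (fun z => Nsum N z (d 0) * ((K z)⁻¹ * B z)) (σ 0)
  | t + 1 =>
      mDeriv (ℓ (t + 1)) (fun z => Nsum N z (d (t + 1)) * (K z)⁻¹) (σ (t + 1)) *
        hChain K B N σ d ℓ t

/-- Right tangential Hermite interpolation vectors. -/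
noncomputable def vHerm {n m : ℕ} (K : ℂ → Matrix (Fin n) (Fin n) ℂ)
    (B : ℂ → Matrix (Fin n) (Fin m) ℂ) (N : Fin m → ℂ → Matrix (Fin n) (Fin n) ℂ)
    (σ : ℕ → ℂ) (d : ℕ → Fin m → ℂ) (ℓ : ℕ → ℕ) (b : Fin m → ℂ) : ℕ → ℕ → Fin n → ℂ
  | 0, j => mDeriv j (fun z => (K z)⁻¹ * B z) (σ 0) *ᵥ b
  | t + 1, j => (mDeriv j (fun z => (K z)⁻¹) (σ (t + 1)) * hChain K B N σ d ℓ t) *ᵥ b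

/-- Left tangential Hermite interpolation vectors (with reversed sequences). -/
noncomputable def wHerm {n m p : ℕ} (C : ℂ → Matrix (Fin p) (Fin n) ℂ)
    (K : ℂ → Matrix (Fin n) (Fin n) ℂ) (N : Fin m → ℂ → Matrix (Fin n) (Fin n) ℂ)
    (τ : ℕ → ℂ) (e : ℕ → Fin m → ℂ) (eν : ℕ → ℕ) (c : Fin p → ℂ) : ℕ → ℕ → Fin n → ℂ
  | 0, i => star (vDeriv i (fun z => Matrix.vecMul (star c) (C z * (K z)⁻¹)) (τ 0))
  | t + 1, j =>
      star (vDeriv j (fun z =>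
        Matrix.vecMul (star (wHerm C K N τ e eν c t (eν t))) (Nsum N z (e t) * (K z)⁻¹))
        (τ (t + 1)))

/-- Column index type of the `j+1`-st subsystem transfer function (`m^(j+1)` indices). -/
def colT (m : ℕ) : ℕ → Type
  | 0 => Fin m
  | j + 1 => Fin m × colT m j

def colTFintype (m : ℕ) : ∀ j, Fintype (colT m j)
  | 0 => inferInstanceAs (Fintype (Fin m))
  | j + 1 => letI := colTFintype m j; inferInstanceAs (Fintype (Fin m × colT m j))

attribute [instance] colTFintype

/-- Block index type (`m^j` indices). -/
def outT (m : ℕ) : ℕ → Type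
  | 0 => Fin 1
  | j + 1 => Fin m × outT m j

def outTFintype (m : ℕ) : ∀ j, Fintype (outT m j)
  | 0 => inferInstanceAs (Fintype (Fin 1))
  | j + 1 => letI := outTFintype m j; inferInstanceAs (Fintype (Fin m × outT m j))

attribute [instance] outTFintype

/-- The horizontal concatenation `N(s) = [N_1(s) ⋯ N_m(s)]`. -/
noncomputable def Nbig {n m : ℕ} (N : Fin m → ℂ → Matrix (Fin n) (Fin n) ℂ) (s : ℂ) :
    Matrix (Fin n) (Fin m × Fin n) ℂ :=
  Matrix.of fun i q => N q.1 s i q.2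

/-- The vertical concatenation `Ñ(s)` of `N_1(s), …, N_m(s)`. -/
noncomputable def Ntil {n m : ℕ} (N : Fin m → ℂ → Matrix (Fin n) (Fin n) ℂ) (s : ℂ) :
    Matrix (Fin m × Fin n) (Fin n) ℂ :=
  Matrix.of fun q i => N q.1 s q.2 i

/-- State part of the `j+1`-st subsystem transfer function:
`Z 0 = K(σ 0)⁻¹ B(σ 0)`, `Z (j+1) = K(σ (j+1))⁻¹ N(σ j) (I_m ⊗ Z j)`. -/
noncomputable def Zblk {n m : ℕ} (K : ℂ → Matrix (Fin n) (Fin n) ℂ)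
    (B : ℂ → Matrix (Fin n) (Fin m) ℂ) (N : Fin m → ℂ → Matrix (Fin n) (Fin n) ℂ)
    (σ : ℕ → ℂ) : (j : ℕ) → Matrix (Fin n) (colT m j) ℂ
  | 0 => (K (σ 0))⁻¹ * B (σ 0)
  | j + 1 =>
      (K (σ (j + 1)))⁻¹ * Nbig N (σ j) *
        ((1 : Matrix (Fin m) (Fin m) ℂ) ⊗ₖ Zblk K B N σ j)

/-- The `q+1`-st subsystem transfer function `G_{q+1}(σ 0, …, σ q)`. -/
noncomputable def Gblk {n m p : ℕ} (C : ℂ → Matrix (Fin p) (Fin n) ℂ)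
    (K : ℂ → Matrix (Fin n) (Fin n) ℂ) (B : ℂ → Matrix (Fin n) (Fin m) ℂ)
    (N : Fin m → ℂ → Matrix (Fin n) (Fin n) ℂ) (σ : ℕ → ℂ) (q : ℕ) :
    Matrix (Fin p) (colT m q) ℂ :=
  C (σ q) * Zblk K B N σ q

/-- The tangential direction matrix `I_{m^j} ⊗ b`. -/
noncomputable def tangMat {m : ℕ} (b : Fin m → ℂ) :
    (j : ℕ) → Matrix (colT m j) (outT m j) ℂ
  | 0 => Matrix.of fun i _ => b i
  | j + 1 => (1 : Matrix (Fin m) (Fin m) ℂ) ⊗ₖ tangMat b j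

/-- Blockwise right interpolation matrices:
`V 0 = K(σ 0)⁻¹ B(σ 0) b`, `V (j+1) = K(σ (j+1))⁻¹ N(σ j) (I_m ⊗ V j)`. -/
noncomputable def Vblk {n m : ℕ} (K : ℂ → Matrix (Fin n) (Fin n) ℂ)
    (B : ℂ → Matrix (Fin n) (Fin m) ℂ) (N : Fin m → ℂ → Matrix (Fin n) (Fin n) ℂ)
    (σ : ℕ → ℂ) (b : Fin m → ℂ) : (j : ℕ) → Matrix (Fin n) (outT m j) ℂ
  | 0 => Matrix.of fun i _ => ((K (σ 0))⁻¹ *ᵥ (B (σ 0) *ᵥ b)) i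
  | j + 1 =>
      (K (σ (j + 1)))⁻¹ * Nbig N (σ j) *
        ((1 : Matrix (Fin m) (Fin m) ℂ) ⊗ₖ Vblk K B N σ b j)

/-- Blockwise left interpolation matrices (with reversed point sequence `τ`):
`W 0 = K(τ 0)^{-ᴴ} C(τ 0)ᴴ c`, `W (t+1) = K(τ (t+1))^{-ᴴ} Ñ(τ (t+1))ᴴ (I_m ⊗ W t)`. -/
noncomputable def Wblk {n m p : ℕ} (C : ℂ → Matrix (Fin p) (Fin n) ℂ)
    (K : ℂ → Matrix (Fin n) (Fin n) ℂ) (N : Fin m → ℂ → Matrix (Fin n) (Fin n) ℂ)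
    (τ : ℕ → ℂ) (c : Fin p → ℂ) : (t : ℕ) → Matrix (Fin n) (outT m t) ℂ
  | 0 => Matrix.of fun i _ => (((K (τ 0))⁻¹)ᴴ *ᵥ ((C (τ 0))ᴴ *ᵥ c)) i
  | t + 1 =>
      ((K (τ (t + 1)))⁻¹)ᴴ * (Ntil N (τ (t + 1)))ᴴ *
        ((1 : Matrix (Fin m) (Fin m) ℂ) ⊗ₖ Wblk C K N τ c t)

/-- A vector as a one-column matrix. -/
noncomputable def bCol {m : ℕ} (b : Fin m → ℂ) : Matrix (Fin m) (Fin 1) ℂ :=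
  Matrix.of fun i _ => b i

/-- Blockwise Hermite chain. -/
noncomputable def hChainB {n m : ℕ} (K : ℂ → Matrix (Fin n) (Fin n) ℂ)
    (B : ℂ → Matrix (Fin n) (Fin m) ℂ) (N : Fin m → ℂ → Matrix (Fin n) (Fin n) ℂ)
    (σ : ℕ → ℂ) (ℓ : ℕ → ℕ) (b : Fin m → ℂ) :
    (t : ℕ) → Matrix (Fin n) (outT m (t + 1)) ℂ
  | 0 => mDeriv (ℓ 0)
      (fun z => Nbig N z * ((1 : Matrix (Fin m) (Fin m) ℂ) ⊗ₖ ((K z)⁻¹ * B z * bCol b)))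
      (σ 0)
  | t + 1 =>
      mDeriv (ℓ (t + 1))
        (fun z => Nbig N z * ((1 : Matrix (Fin m) (Fin m) ℂ) ⊗ₖ (K z)⁻¹)) (σ (t + 1)) *
        ((1 : Matrix (Fin m) (Fin m) ℂ) ⊗ₖ hChainB K B N σ ℓ b t)

/-- Blockwise right Hermite interpolation matrices. -/
noncomputable def vHermB {n m : ℕ} (K : ℂ → Matrix (Fin n) (Fin n) ℂ)
    (B : ℂ → Matrix (Fin n) (Fin m) ℂ) (N : Fin m → ℂ → Matrix (Fin n) (Fin n) ℂ)
    (σ : ℕ → ℂ) (ℓ : ℕ → ℕ) (b : Fin m → ℂ) : (t : ℕ) → ℕ → Matrix (Fin n) (outT m t) ℂ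
  | 0, j => mDeriv j (fun z => (K z)⁻¹ * B z * bCol b) (σ 0)
  | t + 1, j => mDeriv j (fun z => (K z)⁻¹) (σ (t + 1)) * hChainB K B N σ ℓ b t

/-- Blockwise left Hermite interpolation matrices (with reversed sequences). -/
noncomputable def wHermB {n m p : ℕ} (C : ℂ → Matrix (Fin p) (Fin n) ℂ)
    (K : ℂ → Matrix (Fin n) (Fin n) ℂ) (N : Fin m → ℂ → Matrix (Fin n) (Fin n) ℂ)
    (τ : ℕ → ℂ) (eν : ℕ → ℕ) (c : Fin p → ℂ) : (t : ℕ) → ℕ → Matrix (Fin n) (outT m t) ℂ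
  | 0, i => Matrix.of fun idx _ =>
      star (iteratedDeriv i (fun z => Matrix.vecMul (star c) (C z * (K z)⁻¹) idx) (τ 0))
  | t + 1, j => Matrix.of fun idx cc =>
      star (iteratedDeriv j (fun z =>
        (((1 : Matrix (Fin m) (Fin m) ℂ) ⊗ₖ wHermB C K N τ eν c t (eν t))ᴴ * Ntil N z *
          (K z)⁻¹) cc idx) (τ (t + 1)))

/-- The Kronecker product `d (j-1) ⊗ ⋯ ⊗ d 0 ⊗ I_m` of scaling vectors with the identity. -/
noncomputable def dKron {m : ℕ} (d : ℕ → Fin m → ℂ) :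
    (j : ℕ) → Matrix (colT m j) (Fin m) ℂ
  | 0 => (1 : Matrix (Fin m) (Fin m) ℂ)
  | j + 1 => Matrix.of fun (pq : Fin m × colT m j) cix => d j pq.1 * dKron d j pq.2 cix

/-- The innermost (input) coordinate of a column multi-index. -/
def innerIdx (m : ℕ) : (j : ℕ) → colT m j → Fin m
  | 0 => fun x => x
  | j + 1 => fun (pq : Fin m × colT m j) => innerIdx m j pq.2

/-- The chain `K(σ t)⁻¹ N_{J (t-1)}(σ (t-1)) ⋯ N_{J 0}(σ 0) K(σ 0)⁻¹ B(σ 0)`. -/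
noncomputable def eChain {n m : ℕ} (K : ℂ → Matrix (Fin n) (Fin n) ℂ)
    (B : ℂ → Matrix (Fin n) (Fin m) ℂ) (N : Fin m → ℂ → Matrix (Fin n) (Fin n) ℂ)
    (σ : ℕ → ℂ) (J : ℕ → Fin m) : ℕ → Matrix (Fin n) (Fin m) ℂ
  | 0 => (K (σ 0))⁻¹ * B (σ 0)
  | t + 1 => (K (σ (t + 1)))⁻¹ * N (J t) (σ t) * eChain K B N σ J t

/-- Multiplying by `I_m ⊗ Z` on the right of `[N_1 ⋯ N_m]` gives the blocks `N_i Z`. -/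
lemma Nbig_mul_kronecker_apply {n m : ℕ} {β : Type*} (N : Fin m → ℂ → Matrix (Fin n) (Fin n) ℂ)
    (s : ℂ) (Z : Matrix (Fin n) β ℂ) (a : Fin n) (i : Fin m) (q : β) :
    (Nbig N s * ((1 : Matrix (Fin m) (Fin m) ℂ) ⊗ₖ Z)) a (i, q) = (N i s * Z) a q := by
  simp [Matrix.mul_apply, Nbig, Fintype.sum_prod_type, Matrix.one_apply]

/-- Multiplying by `I_m ⊗ Z` on the right of `Ñᴴ` gives the blocks `N_iᴴ Z`. -/
lemma Ntil_conjTranspose_mul_kronecker_apply {n m : ℕ} {β : Type*}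
    (N : Fin m → ℂ → Matrix (Fin n) (Fin n) ℂ)
    (s : ℂ) (Z : Matrix (Fin n) β ℂ) (a : Fin n) (i : Fin m) (q : β) :
    ((Ntil N s)ᴴ * ((1 : Matrix (Fin m) (Fin m) ℂ) ⊗ₖ Z)) a (i, q) = ((N i s)ᴴ * Z) a q := by
  simp [Matrix.mul_apply, Ntil, Fintype.sum_prod_type, Matrix.one_apply]

lemma mulVec_Zblk_zero {n m : ℕ} {K : ℂ → Matrix (Fin n) (Fin n) ℂ}
    (B : ℂ → Matrix (Fin n) (Fin m) ℂ) (N : Fin m → ℂ → Matrix (Fin n) (Fin n) ℂ)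
    {σ : ℕ → ℂ} (hK : IsUnit (K (σ 0)).det) (q : colT m 0) :
    K (σ 0) *ᵥ (Zblk K B N σ 0).col q = (B (σ 0)).col q := by
  change (K (σ 0) * ((K (σ 0))⁻¹ * B (σ 0))).col q = _
  rw [Matrix.mul_nonsing_inv_cancel_left _ _ hK]

lemma mulVec_Zblk_succ {n m : ℕ} {K : ℂ → Matrix (Fin n) (Fin n) ℂ}
    (B : ℂ → Matrix (Fin n) (Fin m) ℂ) (N : Fin m → ℂ → Matrix (Fin n) (Fin n) ℂ)
    {σ : ℕ → ℂ} {j : ℕ} (hK : IsUnit (K (σ (j + 1))).det) (i : Fin m) (q : colT m j) :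
    K (σ (j + 1)) *ᵥ (Zblk K B N σ (j + 1)).col (i, q) =
      N i (σ j) *ᵥ (Zblk K B N σ j).col q := by
  change (K (σ (j + 1)) * ((K (σ (j + 1)))⁻¹ * Nbig N (σ j) *
    ((1 : Matrix (Fin m) (Fin m) ℂ) ⊗ₖ Zblk K B N σ j))).col (i, q) = _
  rw [Matrix.mul_assoc (K (σ (j + 1)))⁻¹, Matrix.mul_nonsing_inv_cancel_left _ _ hK]
  ext a
  exact Nbig_mul_kronecker_apply N (σ j) (Zblk K B N σ j) a i q

lemma star_Wblk_zero_vecMul {n m p : ℕ} (C : ℂ → Matrix (Fin p) (Fin n) ℂ)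
    {K : ℂ → Matrix (Fin n) (Fin n) ℂ} (N : Fin m → ℂ → Matrix (Fin n) (Fin n) ℂ)
    {τ : ℕ → ℂ} (c : Fin p → ℂ) (hK : IsUnit (K (τ 0)).det) (q : outT m 0) :
    star ((Wblk C K N τ c 0).col q) ᵥ* K (τ 0) = star c ᵥ* C (τ 0) := by
  change star (((K (τ 0))⁻¹)ᴴ *ᵥ ((C (τ 0))ᴴ *ᵥ c)) ᵥ* K (τ 0) = _
  simp [Matrix.star_mulVec, Matrix.vecMul_vecMul, Matrix.mul_assoc, Matrix.nonsing_inv_mul _ hK]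

lemma star_Wblk_succ_vecMul {n m p : ℕ} (C : ℂ → Matrix (Fin p) (Fin n) ℂ)
    {K : ℂ → Matrix (Fin n) (Fin n) ℂ} (N : Fin m → ℂ → Matrix (Fin n) (Fin n) ℂ)
    {τ : ℕ → ℂ} (c : Fin p → ℂ) {t : ℕ} (hK : IsUnit (K (τ (t + 1))).det) (i : Fin m)
    (q : outT m t) :
    star ((Wblk C K N τ c (t + 1)).col (i, q)) ᵥ* K (τ (t + 1)) =
      star ((Wblk C K N τ c t).col q) ᵥ* N i (τ (t + 1)) := by
  have h : (Wblk C K N τ c (t + 1)).col (i, q) =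
      ((K (τ (t + 1)))⁻¹)ᴴ *ᵥ ((N i (τ (t + 1)))ᴴ *ᵥ (Wblk C K N τ c t).col q) := by
    change (((K (τ (t + 1)))⁻¹)ᴴ * (Ntil N (τ (t + 1)))ᴴ *
      ((1 : Matrix (Fin m) (Fin m) ℂ) ⊗ₖ Wblk C K N τ c t)).col (i, q) = _
    rw [Matrix.mul_assoc]
    change ((K (τ (t + 1)))⁻¹)ᴴ *ᵥ ((Ntil N (τ (t + 1)))ᴴ *
      ((1 : Matrix (Fin m) (Fin m) ℂ) ⊗ₖ Wblk C K N τ c t)).col (i, q) = _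
    congr 1
    ext a
    exact Ntil_conjTranspose_mul_kronecker_apply N _ (Wblk C K N τ c t) a i q
  rw [h]
  simp [Matrix.star_mulVec, Matrix.vecMul_vecMul, Matrix.mul_assoc, Matrix.nonsing_inv_mul _ hK]

/-- If the column `w = W x` of a left interpolation matrix and all its successors lie in the range
of `W`, then pairing `w` with the full-order chain agrees with pairing `x` with the reduced one. -/
lemma star_Wblk_dotProduct_Zblk {n m p r : ℕ}
    (C : ℂ → Matrix (Fin p) (Fin n) ℂ) (K : ℂ → Matrix (Fin n) (Fin n) ℂ)
    (B : ℂ → Matrix (Fin n) (Fin m) ℂ) (N : Fin m → ℂ → Matrix (Fin n) (Fin n) ℂ)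
    (V W : Matrix (Fin n) (Fin r) ℂ) (σ τ : ℕ → ℂ) (c : Fin p → ℂ) (η : ℕ)
    (hστ : ∀ j t, j + t = η → σ j = τ t)
    (hK : ∀ j ≤ η, IsUnit (K (σ j)).det)
    (hKr : ∀ j ≤ η, IsUnit (Wᴴ * K (σ j) * V).det)
    (hW : ∀ t ≤ η, ∀ q : outT m t, (Wblk C K N τ c t).col q ∈ Set.range W.mulVec)
    (j t : ℕ) (hjt : j + t = η) (q : outT m t) (x : Fin r → ℂ)
    (hx : W *ᵥ x = (Wblk C K N τ c t).col q) (k : colT m j) :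
    star ((Wblk C K N τ c t).col q) ⬝ᵥ (K (σ j) *ᵥ (Zblk K B N σ j).col k) =
      star x ⬝ᵥ ((Wᴴ * K (σ j) * V) *ᵥ
        (Zblk (fun s => Wᴴ * K s * V) (fun s => Wᴴ * B s) (fun ι s => Wᴴ * N ι s * V) σ j).col
          k) := by
  induction j generalizing t x with
  | zero =>
    rw [mulVec_Zblk_zero B N (hK 0 (Nat.zero_le _)),
      mulVec_Zblk_zero (K := fun s => Wᴴ * K s * V) _ _ (hKr 0 (Nat.zero_le _)), ← hx,
      Matrix.star_mulVec, ← Matrix.dotProduct_mulVec]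
    rfl
  | succ j ih =>
    obtain ⟨i, k⟩ := k
    obtain ⟨y, hy⟩ := hW (t + 1) (by omega) (i, q)
    have hs : σ j = τ (t + 1) := hστ j (t + 1) (by omega)
    have hw := star_Wblk_succ_vecMul C N c (hs ▸ hK j (by omega)) i q
    rw [← hs] at hw
    have hred : star y ᵥ* (Wᴴ * K (σ j) * V) = star x ᵥ* (Wᴴ * N i (σ j) * V) := by
      simp only [← Matrix.vecMul_vecMul, ← Matrix.star_mulVec]
      rw [hx, hy, hw]
    rw [mulVec_Zblk_succ B N (hK (j + 1) (by omega)),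
      mulVec_Zblk_succ (K := fun s => Wᴴ * K s * V) _ _ (hKr (j + 1) (by omega)),
      Matrix.dotProduct_mulVec, ← hw, ← Matrix.dotProduct_mulVec,
      ih (t + 1) (by omega) (i, q) y hy k, Matrix.dotProduct_mulVec, hred,
      ← Matrix.dotProduct_mulVec]

theorem stmt_9 {n m p r : ℕ} (hn : 0 < n) (hm : 0 < m) (hp : 0 < p) (hr : 0 < r)
    (C : ℂ → Matrix (Fin p) (Fin n) ℂ) (K : ℂ → Matrix (Fin n) (Fin n) ℂ)
    (B : ℂ → Matrix (Fin n) (Fin m) ℂ) (N : Fin m → ℂ → Matrix (Fin n) (Fin n) ℂ)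
    (V W : Matrix (Fin n) (Fin r) ℂ)
    (κ : ℕ) (hκ : 0 < κ) (ς : ℕ → ℂ) (c : Fin p → ℂ)
    (hK : ∀ i < κ, IsUnit (K (ς i)).det)
    (hKr : ∀ i < κ, IsUnit (Wᴴ * K (ς i) * V).det)
    (hW : ∀ t < κ, ∀ cix : outT m t,
      (fun i => Wblk C K N (fun t => ς (κ - 1 - t)) c t i cix) ∈ Set.range W.mulVec) :
    ∀ η < κ,
      Matrix.vecMul (star c) (Gblk C K B N (fun j => ς (κ - 1 - η + j)) η) =
        Matrix.vecMul (star c)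
          (Gblk (fun s => C s * V) (fun s => Wᴴ * K s * V) (fun s => Wᴴ * B s) (fun ι s => Wᴴ * N ι s * V) (fun j => ς (κ - 1 - η + j)) η) := by
  intro η hη
  set σ : ℕ → ℂ := fun j => ς (κ - 1 - η + j) with hσ
  set τ : ℕ → ℂ := fun t => ς (κ - 1 - t) with hτ
  have hστ : ∀ j t, j + t = η → σ j = τ t := fun j t h => congrArg ς (by omega)
  have hKσ : ∀ j ≤ η, IsUnit (K (σ j)).det := fun j hj => hK _ (by omega)
  have hKrσ : ∀ j ≤ η, IsUnit (Wᴴ * K (σ j) * V).det := fun j hj => hKr _ (by omega)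
  have hWτ : ∀ t ≤ η, ∀ q : outT m t, (Wblk C K N τ c t).col q ∈ Set.range W.mulVec :=
    fun t ht => hW t (by omega)
  let o : outT m 0 := (0 : Fin 1)
  obtain ⟨x, hx⟩ := hWτ 0 (Nat.zero_le _) o
  have hs : σ η = τ 0 := hστ η 0 rfl
  have hw := star_Wblk_zero_vecMul C N c (hs ▸ hKσ η le_rfl) o
  rw [← hs] at hw
  have hred : star x ᵥ* (Wᴴ * K (σ η) * V) = star c ᵥ* (C (σ η) * V) := by
    simp only [← Matrix.vecMul_vecMul, ← Matrix.star_mulVec]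
    rw [hx, hw]
  unfold Gblk
  rw [← Matrix.vecMul_vecMul, ← Matrix.vecMul_vecMul, ← hw, ← hred]
  ext k
  change _ ⬝ᵥ (Zblk K B N σ η).col k = _ ⬝ᵥ (Zblk (fun s => Wᴴ * K s * V) (fun s => Wᴴ * B s)
    (fun ι s => Wᴴ * N ι s * V) σ η).col k
  rw [← Matrix.dotProduct_mulVec, ← Matrix.dotProduct_mulVec]
  exact star_Wblk_dotProduct_Zblk C K B N V W σ τ c η hστ hKσ hKrσ hWτ η 0 rfl o x hx k


end StructBilin
end

section
/- Let σ_1,…,σ_k, ς_1,…,ς_κ ∈ ℂ be such that K and K̂ = Wᴴ K V are invertible at all of these points, and let b ∈ ℂ^m and c ∈ ℂ^p. Let the column space of V contain the columns of V_1 = K(σ_1)^{-1} B(σ_1) b and V_j = K(σ_j)^{-1} N(σ_{j-1}) (I_m ⊗ V_{j-1}) for 2 ≤ j ≤ k, and let the column space of W contain the columns of W_1 = K(ς_κ)^{-ᴴ} C(ς_κ)ᴴ c and W_i = K(ς_{κ-i+1})^{-ᴴ} Ñ(ς_{κ-i+1})ᴴ (I_m ⊗ W_{i-1}) for 2 ≤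 i ≤ κ. Then for all 1 ≤ q ≤ k and 1 ≤ η ≤ κ the blockwise bi-tangential interpolation conditions cᴴ G_{q+η}(σ_1,…,σ_q, ς_{κ-η+1},…,ς_κ)(I_{m^{q+η-1}} ⊗ b) = cᴴ Ĝ_{q+η}(σ_1,…,σ_q, ς_{κ-η+1},…,ς_κ)(I_{m^{q+η-1}} ⊗ b) hold. -/
open Matrix
open scoped Kronecker

namespace StructBilin

section PetrovGalerkin

variable {n m p r : ℕ}

theorem Zblk_mul_tangMat (K : ℂ → Matrix (Fin n) (Fin n) ℂ) (B : ℂ → Matrix (Fin n) (Fin m) ℂ)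
    (N : Fin m → ℂ → Matrix (Fin n) (Fin n) ℂ) (σ : ℕ → ℂ) (b : Fin m → ℂ) (j : ℕ) :
    Zblk K B N σ j * tangMat b j = Vblk K B N σ b j := by
  induction j with
  | zero =>
    ext i l
    change ((K (σ 0))⁻¹ * B (σ 0) * bCol b) i l = ((K (σ 0))⁻¹ *ᵥ (B (σ 0) *ᵥ b)) i
    rw [mulVec_mulVec]
    rfl
  | succ j ih =>
    change (K (σ (j + 1)))⁻¹ * Nbig N (σ j) * ((1 : Matrix (Fin m) (Fin m) ℂ) ⊗ₖ Zblk K B N σ j) *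
        ((1 : Matrix (Fin m) (Fin m) ℂ) ⊗ₖ tangMat b j) =
      (K (σ (j + 1)))⁻¹ * Nbig N (σ j) * ((1 : Matrix (Fin m) (Fin m) ℂ) ⊗ₖ Vblk K B N σ b j)
    rw [Matrix.mul_assoc, ← mul_kronecker_mul, Matrix.one_mul, ih]

theorem Vblk_congr (K : ℂ → Matrix (Fin n) (Fin n) ℂ) (B : ℂ → Matrix (Fin n) (Fin m) ℂ)
    (N : Fin m → ℂ → Matrix (Fin n) (Fin n) ℂ) {σ s : ℕ → ℂ} (b : Fin m → ℂ) {j : ℕ}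
    (h : ∀ i ≤ j, σ i = s i) : Vblk K B N σ b j = Vblk K B N s b j := by
  induction j with
  | zero => simp only [Vblk, h 0 le_rfl]
  | succ j ih =>
    simp only [Vblk, h (j + 1) le_rfl, h j j.le_succ, ih fun i hi => h i (hi.trans j.le_succ)]
    rfl

theorem Vblk_succ_col (K : ℂ → Matrix (Fin n) (Fin n) ℂ) (B : ℂ → Matrix (Fin n) (Fin m) ℂ)
    (N : Fin m → ℂ → Matrix (Fin n) (Fin n) ℂ) (σ : ℕ → ℂ) (b : Fin m → ℂ) (j : ℕ)
    (a : Fin m) (L : outT m j) :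
    (Vblk K B N σ b (j + 1)).col (a, L) =
      (K (σ (j + 1)))⁻¹ *ᵥ (N a (σ j) *ᵥ (Vblk K B N σ b j).col L) := by
  have h : (Nbig N (σ j) * ((1 : Matrix (Fin m) (Fin m) ℂ) ⊗ₖ Vblk K B N σ b j)).col (a, L) =
      N a (σ j) *ᵥ (Vblk K B N σ b j).col L := by
    ext i
    simp [Matrix.mul_apply, Nbig, Fintype.sum_prod_type, kroneckerMap_apply, Matrix.one_apply,
      mulVec, dotProduct]
  rw [← h, Vblk, Matrix.mul_assoc]
  rfl

theorem Wblk_succ_col (C : ℂ → Matrix (Fin p) (Fin n) ℂ) (K : ℂ → Matrix (Fin n) (Fin n) ℂ)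
    (N : Fin m → ℂ → Matrix (Fin n) (Fin n) ℂ) (τ : ℕ → ℂ) (c : Fin p → ℂ) (t : ℕ)
    (a : Fin m) (J : outT m t) :
    (Wblk C K N τ c (t + 1)).col (a, J) =
      ((K (τ (t + 1)))⁻¹)ᴴ *ᵥ ((N a (τ (t + 1)))ᴴ *ᵥ (Wblk C K N τ c t).col J) := by
  have h : ((Ntil N (τ (t + 1)))ᴴ *
      ((1 : Matrix (Fin m) (Fin m) ℂ) ⊗ₖ Wblk C K N τ c t)).col (a, J) =
      (N a (τ (t + 1)))ᴴ *ᵥ (Wblk C K N τ c t).col J := by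
    ext i
    simp [Matrix.mul_apply, Ntil, Fintype.sum_prod_type, kroneckerMap_apply, Matrix.one_apply,
      mulVec, dotProduct]
  rw [← h, Wblk, Matrix.mul_assoc]
  rfl

/-- A Petrov–Galerkin projection reproduces a solution that lies in the trial space. -/
theorem mulVec_projected_solve {K : Matrix (Fin n) (Fin n) ℂ} {V W : Matrix (Fin n) (Fin r) ℂ}
    {f : Fin n → ℂ} (hK : IsUnit K.det) (hKr : IsUnit (Wᴴ * K * V).det)
    (hf : K⁻¹ *ᵥ f ∈ Set.range V.mulVec) :
    V *ᵥ ((Wᴴ * K * V)⁻¹ *ᵥ (Wᴴ *ᵥ f)) = K⁻¹ *ᵥ f := by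
  obtain ⟨y, hy⟩ := hf
  have hf' : f = K *ᵥ (V *ᵥ y) := by
    rw [hy, mulVec_mulVec, mul_nonsing_inv _ hK, one_mulVec]
  have h : Wᴴ *ᵥ f = (Wᴴ * K * V) *ᵥ y := by
    rw [hf', mulVec_mulVec, mulVec_mulVec, Matrix.mul_assoc]
  rw [h, mulVec_mulVec _ (Wᴴ * K * V)⁻¹, nonsing_inv_mul _ hKr, one_mulVec, hy]

theorem mulVec_projected_Vblk (K : ℂ → Matrix (Fin n) (Fin n) ℂ)
    (B : ℂ → Matrix (Fin n) (Fin m) ℂ) (N : Fin m → ℂ → Matrix (Fin n) (Fin n) ℂ)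
    (V W : Matrix (Fin n) (Fin r) ℂ) (σ : ℕ → ℂ) (b : Fin m → ℂ) {k : ℕ}
    (hK : ∀ j < k, IsUnit (K (σ j)).det) (hKr : ∀ j < k, IsUnit (Wᴴ * K (σ j) * V).det)
    (hV : ∀ j < k, ∀ L, (Vblk K B N σ b j).col L ∈ Set.range V.mulVec) {j : ℕ} (hj : j < k)
    (L : outT m j) :
    V *ᵥ (Vblk (fun s => Wᴴ * K s * V) (fun s => Wᴴ * B s) (fun ι s => Wᴴ * N ι s * V)
      σ b j).col L = (Vblk K B N σ b j).col L := by
  induction j with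
  | zero =>
    have h := mulVec_projected_solve (hK 0 hj) (hKr 0 hj) (hV 0 hj L)
    rwa [mulVec_mulVec _ Wᴴ] at h
  | succ j ih =>
    obtain ⟨a, L⟩ := L
    have hmem := hV (j + 1) hj (a, L)
    rw [Vblk_succ_col] at hmem
    rw [Vblk_succ_col, Vblk_succ_col, ← mulVec_projected_solve (hK _ hj) (hKr _ hj) hmem,
      ← ih (j.lt_succ_self.trans hj)]
    simp only [mulVec_mulVec, Matrix.mul_assoc]

theorem mulVec_projected_Wblk (C : ℂ → Matrix (Fin p) (Fin n) ℂ)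
    (K : ℂ → Matrix (Fin n) (Fin n) ℂ) (N : Fin m → ℂ → Matrix (Fin n) (Fin n) ℂ)
    (V W : Matrix (Fin n) (Fin r) ℂ) (τ : ℕ → ℂ) (c : Fin p → ℂ) {κ : ℕ}
    (hK : ∀ t < κ, IsUnit (K (τ t)).det) (hKr : ∀ t < κ, IsUnit (Wᴴ * K (τ t) * V).det)
    (hW : ∀ t < κ, ∀ J, (Wblk C K N τ c t).col J ∈ Set.range W.mulVec) {t : ℕ} (ht : t < κ)
    (J : outT m t) :
    W *ᵥ (Wblk (fun s => C s * V) (fun s => Wᴴ * K s * V) (fun ι s => Wᴴ * N ι s * V)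
      τ c t).col J = (Wblk C K N τ c t).col J := by
  have solve : ∀ t < κ, ∀ f : Fin n → ℂ, ((K (τ t))⁻¹)ᴴ *ᵥ f ∈ Set.range W.mulVec →
      W *ᵥ (((Wᴴ * K (τ t) * V)⁻¹)ᴴ *ᵥ (Vᴴ *ᵥ f)) = ((K (τ t))⁻¹)ᴴ *ᵥ f := by
    intro t ht f hf
    have hadj : (Wᴴ * K (τ t) * V)ᴴ = Vᴴ * (K (τ t))ᴴ * W := by
      simp [conjTranspose_mul, Matrix.mul_assoc]
    rw [conjTranspose_nonsing_inv] at hf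
    rw [conjTranspose_nonsing_inv, conjTranspose_nonsing_inv, hadj]
    refine mulVec_projected_solve ?_ ?_ hf
    · rw [det_conjTranspose]
      exact (hK t ht).star
    · rw [← hadj, det_conjTranspose]
      exact (hKr t ht).star
  induction t with
  | zero =>
    have h := solve 0 ht _ (hW 0 ht J)
    rwa [mulVec_mulVec _ Vᴴ, ← conjTranspose_mul] at h
  | succ t ih =>
    obtain ⟨a, J⟩ := J
    have hmem := hW (t + 1) ht (a, J)
    rw [Wblk_succ_col] at hmem
    rw [Wblk_succ_col, Wblk_succ_col, ← solve _ ht _ hmem, ← ih (t.lt_succ_self.trans ht)]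
    simp only [mulVec_mulVec, Matrix.mul_assoc, conjTranspose_mul, conjTranspose_conjTranspose]

theorem star_conjTranspose_mulVec_dotProduct {α β : Type*} [Fintype α] [Fintype β]
    (A : Matrix α β ℂ) (x : α → ℂ) (y : β → ℂ) : star (Aᴴ *ᵥ x) ⬝ᵥ y = star x ⬝ᵥ (A *ᵥ y) := by
  rw [star_mulVec, conjTranspose_conjTranspose, dotProduct_mulVec]

/-- Moving a factor `N_a K⁻¹` from the right chain to the left chain. -/
theorem Wblk_dotProduct_Vblk_succ (C : ℂ → Matrix (Fin p) (Fin n) ℂ)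
    (K : ℂ → Matrix (Fin n) (Fin n) ℂ) (B : ℂ → Matrix (Fin n) (Fin m) ℂ)
    (N : Fin m → ℂ → Matrix (Fin n) (Fin n) ℂ) (s τ : ℕ → ℂ) (b : Fin m → ℂ) (c : Fin p → ℂ)
    {j t : ℕ} (hs : s j = τ (t + 1)) (hK : IsUnit (K (s j)).det) (a : Fin m)
    (J : outT m t) (L : outT m j) :
    star ((Wblk C K N τ c t).col J) ⬝ᵥ (N a (s j) *ᵥ (Vblk K B N s b j).col L) =
      star ((Wblk C K N τ c (t + 1)).col (a, J)) ⬝ᵥ (K (s j) *ᵥ (Vblk K B N s b j).col L) := by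
  rw [Wblk_succ_col, star_conjTranspose_mulVec_dotProduct, star_conjTranspose_mulVec_dotProduct,
    ← hs, mulVec_mulVec _ (K (s j))⁻¹, nonsing_inv_mul _ hK, one_mulVec]

theorem mulVec_Vblk_succ_col (K : ℂ → Matrix (Fin n) (Fin n) ℂ)
    (B : ℂ → Matrix (Fin n) (Fin m) ℂ) (N : Fin m → ℂ → Matrix (Fin n) (Fin n) ℂ) (s : ℕ → ℂ)
    (b : Fin m → ℂ) {j : ℕ} (hK : IsUnit (K (s (j + 1))).det) (a : Fin m) (L : outT m j) :
    K (s (j + 1)) *ᵥ (Vblk K B N s b (j + 1)).col (a, L) =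
      N a (s j) *ᵥ (Vblk K B N s b j).col L := by
  rw [Vblk_succ_col, mulVec_mulVec, mul_nonsing_inv _ hK, one_mulVec]

/-- The tangential values of a subsystem transfer function are pairings of the left and right
chains. -/
theorem vecMul_Gblk_mul_tangMat_apply (C : ℂ → Matrix (Fin p) (Fin n) ℂ)
    (K : ℂ → Matrix (Fin n) (Fin n) ℂ) (B : ℂ → Matrix (Fin n) (Fin m) ℂ)
    (N : Fin m → ℂ → Matrix (Fin n) (Fin n) ℂ) (s τ : ℕ → ℂ) (b : Fin m → ℂ) (c : Fin p → ℂ)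
    {j : ℕ} (hs : s j = τ 0) (hK : IsUnit (K (s j)).det) (J : outT m 0) (L : outT m j) :
    vecMul (star c) (Gblk C K B N s j * tangMat b j) L =
      star ((Wblk C K N τ c 0).col J) ⬝ᵥ (K (s j) *ᵥ (Vblk K B N s b j).col L) := by
  have h : (Wblk C K N τ c 0).col J = ((K (s j))⁻¹)ᴴ *ᵥ ((C (s j))ᴴ *ᵥ c) := by
    rw [hs]
    rfl
  rw [h, star_conjTranspose_mulVec_dotProduct, star_conjTranspose_mulVec_dotProduct,
    mulVec_mulVec _ (K (s j))⁻¹, nonsing_inv_mul _ hK, one_mulVec, Gblk, Matrix.mul_assoc,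
    Zblk_mul_tangMat]
  rfl

/-- Two bilinear systems whose chains have equal pairings through the bilinear terms at `s q` have
equal tangential subsystem transfer function values. -/
theorem vecMul_Gblk_mul_tangMat_congr
    {C : ℂ → Matrix (Fin p) (Fin n) ℂ} {K : ℂ → Matrix (Fin n) (Fin n) ℂ}
    {B : ℂ → Matrix (Fin n) (Fin m) ℂ} {N : Fin m → ℂ → Matrix (Fin n) (Fin n) ℂ}
    {C' : ℂ → Matrix (Fin p) (Fin r) ℂ} {K' : ℂ → Matrix (Fin r) (Fin r) ℂ}
    {B' : ℂ → Matrix (Fin r) (Fin m) ℂ} {N' : Fin m → ℂ → Matrix (Fin r) (Fin r) ℂ}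
    {s τ : ℕ → ℂ} {b : Fin m → ℂ} {c : Fin p → ℂ} {q η : ℕ}
    (hs : ∀ e t, t + e = η → s (q + e + 1) = τ t)
    (hK : ∀ t ≤ η, IsUnit (K (τ t)).det) (hK' : ∀ t ≤ η, IsUnit (K' (τ t)).det)
    (hpair : ∀ a J L,
      star ((Wblk C K N τ c η).col J) ⬝ᵥ (N a (s q) *ᵥ (Vblk K B N s b q).col L) =
        star ((Wblk C' K' N' τ c η).col J) ⬝ᵥ (N' a (s q) *ᵥ (Vblk K' B' N' s b q).col L)) :
    vecMul (star c) (Gblk C K B N s (q + η + 1) * tangMat b (q + η + 1)) =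
      vecMul (star c) (Gblk C' K' B' N' s (q + η + 1) * tangMat b (q + η + 1)) := by
  have hKs : ∀ e t, t + e = η → IsUnit (K (s (q + e + 1))).det := fun e t h => by
    rw [hs e t h]
    exact hK t (by omega)
  have hKs' : ∀ e t, t + e = η → IsUnit (K' (s (q + e + 1))).det := fun e t h => by
    rw [hs e t h]
    exact hK' t (by omega)
  have key : ∀ e t, t + e = η → ∀ (J : outT m t) (L : outT m (q + e + 1)),
      star ((Wblk C K N τ c t).col J) ⬝ᵥ
          (K (s (q + e + 1)) *ᵥ (Vblk K B N s b (q + e + 1)).col L) =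
        star ((Wblk C' K' N' τ c t).col J) ⬝ᵥ
          (K' (s (q + e + 1)) *ᵥ (Vblk K' B' N' s b (q + e + 1)).col L) := by
    intro e
    induction e with
    | zero =>
      rintro t rfl J ⟨a, L⟩
      erw [mulVec_Vblk_succ_col K B N s b (hKs 0 t rfl) a L,
        mulVec_Vblk_succ_col K' B' N' s b (hKs' 0 t rfl) a L]
      exact hpair a J L
    | succ e ih =>
      rintro t h J ⟨a, L⟩
      have h' : t + 1 + e = η := by omega
      erw [mulVec_Vblk_succ_col K B N s b (hKs (e + 1) t h) a L,
        mulVec_Vblk_succ_col K' B' N' s b (hKs' (e + 1) t h) a L,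
        Wblk_dotProduct_Vblk_succ C K B N s τ b c (hs e (t + 1) h') (hKs e _ h'),
        Wblk_dotProduct_Vblk_succ C' K' B' N' s τ b c (hs e (t + 1) h') (hKs' e _ h')]
      exact ih (t + 1) h' (a, J) L
  ext L
  rw [vecMul_Gblk_mul_tangMat_apply C K B N s τ b c (hs η 0 (by omega)) (hKs η 0 (by omega))
      (0 : Fin 1) L,
    vecMul_Gblk_mul_tangMat_apply C' K' B' N' s τ b c (hs η 0 (by omega)) (hKs' η 0 (by omega))
      (0 : Fin 1) L]
  exact key η 0 (by omega) _ L

end PetrovGalerkin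

theorem stmt_10 {n m p r : ℕ} (hn : 0 < n) (hm : 0 < m) (hp : 0 < p) (hr : 0 < r)
    (C : ℂ → Matrix (Fin p) (Fin n) ℂ) (K : ℂ → Matrix (Fin n) (Fin n) ℂ)
    (B : ℂ → Matrix (Fin n) (Fin m) ℂ) (N : Fin m → ℂ → Matrix (Fin n) (Fin n) ℂ)
    (V W : Matrix (Fin n) (Fin r) ℂ)
    (k κ : ℕ) (hk : 0 < k) (hκ : 0 < κ) (σ ς : ℕ → ℂ) (b : Fin m → ℂ) (c : Fin p → ℂ)
    (hK : ∀ j < k, IsUnit (K (σ j)).det)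
    (hK' : ∀ i < κ, IsUnit (K (ς i)).det)
    (hKr : ∀ j < k, IsUnit (Wᴴ * K (σ j) * V).det)
    (hKr' : ∀ i < κ, IsUnit (Wᴴ * K (ς i) * V).det)
    (hV : ∀ j < k, ∀ cix : outT m j,
      (fun i => Vblk K B N σ b j i cix) ∈ Set.range V.mulVec)
    (hW : ∀ t < κ, ∀ cix : outT m t,
      (fun i => Wblk C K N (fun t => ς (κ - 1 - t)) c t i cix) ∈ Set.range W.mulVec) :
    ∀ q < k, ∀ η < κ,
      Matrix.vecMul (star c)
          (Gblk C K B N (fun j => if j ≤ q then σ j else ς (κ - 1 - η + (j - (q + 1))))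
              (q + η + 1) *
            tangMat b (q + η + 1)) =
        Matrix.vecMul (star c)
          (Gblk (fun s => C s * V) (fun s => Wᴴ * K s * V) (fun s => Wᴴ * B s) (fun ι s => Wᴴ * N ι s * V)
              (fun j => if j ≤ q then σ j else ς (κ - 1 - η + (j - (q + 1))))
              (q + η + 1) *
            tangMat b (q + η + 1)) := by
  intro q hq η hη
  have hσ : ∀ i ≤ q, (if i ≤ q then σ i else ς (κ - 1 - η + (i - (q + 1)))) = σ i :=
    fun i hi => if_pos hi
  refine vecMul_Gblk_mul_tangMat_congr (τ := fun t => ς (κ - 1 - t)) ?_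
    (fun t _ => hK' _ (by omega)) (fun t _ => hKr' _ (by omega)) ?_
  · intro e t h
    rw [if_neg (by omega)]
    congr 1
    omega
  · intro a J L
    rw [Vblk_congr K B N b hσ, Vblk_congr _ _ _ b hσ, hσ q le_rfl,
      ← mulVec_projected_Vblk K B N V W σ b hK hKr hV hq L,
      ← mulVec_projected_Wblk C K N V W _ c (fun t _ => hK' _ (by omega))
        (fun t _ => hKr' _ (by omega)) hW hη J]
    rw [← conjTranspose_conjTranspose W, star_conjTranspose_mulVec_dotProduct]
    simp only [mulVec_mulVec, Matrix.mul_assoc, conjTranspose_conjTranspose]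

end StructBilin
end

section
/- Suppose C, K, B, and all N_j are analytic at σ_1,…,σ_k ∈ ℂ and that K(σ_i) and K̂(σ_i) = Wᴴ K(σ_i) V are invertible for all i = 1,…,k. Let b ∈ ℂ^m and let ℓ_1,…,ℓ_k be nonnegative integers. Define V_{1,j_1} = ∂_{s^{j_1}}(K^{-1}B b)(σ_1) for j_1 = 0,…,ℓ_1, and for 2 ≤ i ≤ k, V_{i,j_i} = ∂_{s^{j_i}}K^{-1}(σ_i) · ∂_{s^{ℓ_{i-1}}}((I_{m^{i-3}} ⊗ N)(I_{m^{i-2}} ⊗ K^{-1}))(σ_{i-1}) ⋯ ∂_{s^{ℓ_2}}((I_m ⊗ N)(I_{m^2} ⊗ K^{-1}))(σ_2) · ∂_{s^{ℓ_1}}((I_{m^{i-2}} ⊗ N)(I_{m^{i-1}} ⊗ K^{-1} B b))(σ_1) for j_i = 0,…,ℓ_i, following the recursive blockwise pattern V_{i,j_i} = ∂_{s^{j_i}}K^{-1}(σ_i) N(σ_{i-1})(I_m ⊗ fixed-order-ℓ_{i-1} derivative data), i.e., the derivative analogue of V_j = K(σ_j)^{-1} N(σ_{j-1})(I_m ⊗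 V_{j-1}). If the columns of all V_{i,j_i} lie in the column space of V, then for every 1 ≤ q ≤ k and every j_q = 0,…,ℓ_q the blockwise tangential Hermite interpolation conditions ∂_{s_1^{ℓ_1} ⋯ s_{q-1}^{ℓ_{q-1}} s_q^{j_q}} G_q(σ_1,…,σ_q)(I_{m^{q-1}} ⊗ b) = ∂_{s_1^{ℓ_1} ⋯ s_{q-1}^{ℓ_{q-1}} s_q^{j_q}} Ĝ_q(σ_1,…,σ_q)(I_{m^{q-1}} ⊗ b) hold. -/
open Matrix
open scoped Kronecker

namespace StructBilin

section Analytic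

variable {α β γ δ : Type*}

/-- Entrywise analyticity of a matrix-valued function at a point. -/
def EntryAnalytic (f : ℂ → Matrix α β ℂ) (z : ℂ) : Prop :=
  ∀ i j, AnalyticAt ℂ (fun w => f w i j) z

theorem EntryAnalytic.const (M : Matrix α β ℂ) (z : ℂ) : EntryAnalytic (fun _ => M) z :=
  fun _ _ => analyticAt_const

theorem EntryAnalytic.mul [Fintype β] {f : ℂ → Matrix α β ℂ} {g : ℂ → Matrix β γ ℂ} {z : ℂ}
    (hf : EntryAnalytic f z) (hg : EntryAnalytic g z) :
    EntryAnalytic (fun w => f w * g w) z := by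
  intro i j
  simp only [Matrix.mul_apply]
  exact Finset.analyticAt_fun_sum _ fun k _ => (hf i k).mul (hg k j)

theorem EntryAnalytic.det [Fintype α] [DecidableEq α] {f : ℂ → Matrix α α ℂ} {z : ℂ}
    (hf : EntryAnalytic f z) : AnalyticAt ℂ (fun w => (f w).det) z := by
  simp only [Matrix.det_apply']
  exact Finset.analyticAt_fun_sum _ fun k _ => analyticAt_const.mul
    (Finset.analyticAt_fun_prod _ fun i _ => hf _ _)

theorem EntryAnalytic.inv [Fintype α] [DecidableEq α] {f : ℂ → Matrix α α ℂ} {z : ℂ}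
    (hf : EntryAnalytic f z) (hz : IsUnit (f z).det) :
    EntryAnalytic (fun w => (f w)⁻¹) z := by
  intro i j
  simp only [Matrix.inv_def, Matrix.smul_apply, Ring.inverse_eq_inv', smul_eq_mul,
    Matrix.adjugate_apply]
  refine (hf.det.inv hz.ne_zero).mul (EntryAnalytic.det fun a c => ?_)
  by_cases h : a = j
  · subst h
    simpa using analyticAt_const
  · simpa [Matrix.updateRow_ne h] using hf a c

theorem EntryAnalytic.eventually_isUnit_det [Fintype α] [DecidableEq α]
    {f : ℂ → Matrix α α ℂ} {z : ℂ} (hf : EntryAnalytic f z) (hz : IsUnit (f z).det) :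
    ∀ᶠ w in nhds z, IsUnit (f w).det := by
  filter_upwards [hf.det.continuousAt.eventually_ne hz.ne_zero] with w hw
  exact isUnit_iff_ne_zero.2 hw

theorem iteratedDeriv_entry_mul [Fintype β] {f : ℂ → Matrix α β ℂ} {g : ℂ → Matrix β γ ℂ}
    {z : ℂ} (hf : EntryAnalytic f z) (hg : EntryAnalytic g z) (t : ℕ) (i : α) (j : γ) :
    iteratedDeriv t (fun w => (f w * g w) i j) z =
      ∑ k, iteratedDeriv t (fun w => f w i k * g w k j) z := by
  simp only [Matrix.mul_apply]
  exact iteratedDeriv_fun_sum fun k _ => ((hf i k).mul (hg k j)).contDiffAt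

theorem mDeriv_mul_const [Fintype β] {f : ℂ → Matrix α β ℂ} {z : ℂ} (hf : EntryAnalytic f z)
    (M : Matrix β γ ℂ) (t : ℕ) : mDeriv t (fun w => f w * M) z = mDeriv t f z * M := by
  ext i j
  rw [mDeriv, Matrix.of_apply, iteratedDeriv_entry_mul hf (EntryAnalytic.const M z)]
  simp [mDeriv, Matrix.mul_apply]

theorem mDeriv_const_mul [Fintype β] {f : ℂ → Matrix β γ ℂ} {z : ℂ} (hf : EntryAnalytic f z)
    (M : Matrix α β ℂ) (t : ℕ) : mDeriv t (fun w => M * f w) z = M * mDeriv t f z := by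
  ext i j
  rw [mDeriv, Matrix.of_apply, iteratedDeriv_entry_mul (EntryAnalytic.const M z) hf]
  simp [mDeriv, Matrix.mul_apply]

theorem mDeriv_congr {f g : ℂ → Matrix α β ℂ} {z : ℂ} (h : ∀ᶠ w in nhds z, f w = g w) (t : ℕ) :
    mDeriv t f z = mDeriv t g z := by
  ext i j
  refine Filter.EventuallyEq.iteratedDeriv_eq t ?_
  filter_upwards [h] with w hw
  rw [hw]

/-- Equality of the jets of order `L` of two matrix-valued functions. -/
def JetEq (L : ℕ) (f g : ℂ → Matrix α β ℂ) (z : ℂ) : Prop :=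
  ∀ t ≤ L, mDeriv t f z = mDeriv t g z

theorem JetEq.mul_left [Fintype β] {L : ℕ} {A : ℂ → Matrix α β ℂ} {f g : ℂ → Matrix β γ ℂ} {z : ℂ}
    (h : JetEq L f g z) (hA : EntryAnalytic A z) (hf : EntryAnalytic f z)
    (hg : EntryAnalytic g z) : JetEq L (fun w => A w * f w) (fun w => A w * g w) z := by
  intro t ht
  ext i j
  simp only [mDeriv, Matrix.of_apply]
  rw [iteratedDeriv_entry_mul hA hf, iteratedDeriv_entry_mul hA hg]
  refine Finset.sum_congr rfl fun k _ => ?_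
  rw [iteratedDeriv_fun_mul (hA i k).contDiffAt (hf k j).contDiffAt,
    iteratedDeriv_fun_mul (hA i k).contDiffAt (hg k j).contDiffAt]
  refine Finset.sum_congr rfl fun u _ => ?_
  congr 1
  exact congrFun (congrFun (h (t - u) ((Nat.sub_le _ _).trans ht)) k) j

/-- Projection of linear systems preserves jets of solutions lying in the range of `V`. -/
theorem jetEq_projected [Fintype α] [DecidableEq α] [Fintype δ] [DecidableEq δ] {L : ℕ}
    {K : ℂ → Matrix α α ℂ} {R : ℂ → Matrix α γ ℂ} {z : ℂ} {V : Matrix α δ ℂ} {W : Matrix δ α ℂ}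
    (hK : EntryAnalytic K z) (hR : EntryAnalytic R z) (hu : IsUnit (K z).det)
    (hur : IsUnit (W * K z * V).det)
    (hV : ∀ t ≤ L, ∃ Y : Matrix δ γ ℂ, mDeriv t (fun w => (K w)⁻¹ * R w) z = V * Y) :
    JetEq L (fun w => (K w)⁻¹ * R w) (fun w => V * ((W * K w * V)⁻¹ * (W * R w))) z := by
  set x := fun w => (K w)⁻¹ * R w with hx
  have hxa : EntryAnalytic x z := (hK.inv hu).mul hR
  have hKr : EntryAnalytic (fun w => W * K w * V) z :=
    ((EntryAnalytic.const W z).mul hK).mul (EntryAnalytic.const V z)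
  have hWR : EntryAnalytic (fun w => W * R w) z := (EntryAnalytic.const W z).mul hR
  set P : Matrix δ α ℂ := (W * K z * V)⁻¹ * (W * K z) with hP
  have hPV : P * V = 1 := by
    rw [hP, Matrix.mul_assoc, Matrix.nonsing_inv_mul _ hur]
  have hPx : EntryAnalytic (fun w => P * x w) z := (EntryAnalytic.const P z).mul hxa
  have hVPx : EntryAnalytic (fun w => V * (P * x w)) z := (EntryAnalytic.const V z).mul hPx
  have h1 : JetEq L x (fun w => V * (P * x w)) z := by
    intro t ht
    obtain ⟨Y, hY⟩ := hV t ht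
    rw [mDeriv_const_mul hPx, mDeriv_const_mul hxa, hY, ← Matrix.mul_assoc P, hPV, Matrix.one_mul]
  have h2 := h1.mul_left (((hKr.inv hur).mul (EntryAnalytic.const W z)).mul hK) hxa hVPx
  have h3 : JetEq L (fun w => (W * K w * V)⁻¹ * (W * R w)) (fun w => P * x w) z := by
    intro t ht
    refine (mDeriv_congr ?_ t).trans ((h2 t ht).trans (mDeriv_congr ?_ t))
    · filter_upwards [hK.eventually_isUnit_det hu] with w hw
      simp only [hx, Matrix.mul_assoc]
      rw [Matrix.mul_nonsing_inv_cancel_left _ _ hw]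
    · filter_upwards [hKr.eventually_isUnit_det hur] with w hw
      rw [← Matrix.mul_assoc _ V, Matrix.mul_assoc _ W, Matrix.mul_assoc _ (W * K w),
        Matrix.nonsing_inv_mul _ hw, Matrix.one_mul]
  intro t ht
  rw [h1 t ht, mDeriv_const_mul hPx, ← h3 t ht, mDeriv_const_mul ((hKr.inv hur).mul hWR)]

end Analytic

section MixedDerivative

theorem iterate_pD (t k : ℕ) (f : (ℕ → ℂ) → ℂ) (s : ℕ → ℂ) :
    (pD t)^[k] f s = iteratedDeriv k (fun z => f (Function.update s t z)) (s t) := by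
  induction k generalizing s with
  | zero => simp
  | succ k ih =>
    rw [Function.iterate_succ_apply', pD, iteratedDeriv_succ]
    congr 1
    funext z
    rw [ih]
    simp

theorem mixedD_congr (ord : ℕ → ℕ) (t : ℕ) {f g : (ℕ → ℂ) → ℂ} {σ : ℕ → ℂ}
    (h : ∀ s : ℕ → ℂ, (∀ i, t ≤ i → s i = σ i) → f s = g s) :
    mixedD ord t f σ = mixedD ord t g σ := by
  induction t generalizing f g with
  | zero => exact h σ fun _ _ => rfl
  | succ t ih =>
    refine ih fun s hs => ?_
    rw [iterate_pD, iterate_pD]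
    congr 1
    funext z
    refine h _ fun i hi => ?_
    rw [Function.update_of_ne (by omega)]
    exact hs i (by omega)

end MixedDerivative

section Blockwise

variable {n m p : ℕ}

theorem Nbig_mul_kron {β : Type*} (N : Fin m → ℂ → Matrix (Fin n) (Fin n) ℂ) (z : ℂ)
    (Y : Matrix (Fin n) β ℂ) (e : Fin n) (i : Fin m) (j : β) :
    (Nbig N z * ((1 : Matrix (Fin m) (Fin m) ℂ) ⊗ₖ Y)) e (i, j) = (N i z * Y) e j := by
  simp [Nbig, Matrix.mul_apply, Fintype.sum_prod_type, Matrix.kroneckerMap_apply,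
    Matrix.one_apply]

theorem mul_Nbig_mul_kron {β : Type*} (N : Fin m → ℂ → Matrix (Fin n) (Fin n) ℂ) (z : ℂ)
    (C : Matrix (Fin p) (Fin n) ℂ) (M : Matrix (Fin n) (Fin n) ℂ) (Y : Matrix (Fin n) β ℂ)
    (a : Fin p) (i : Fin m) (j : β) :
    (C * (M * Nbig N z * ((1 : Matrix (Fin m) (Fin m) ℂ) ⊗ₖ Y))) a (i, j) =
      (C * M * (N i z * Y)) a j := by
  rw [Matrix.mul_assoc M, ← Matrix.mul_assoc C, Matrix.mul_apply, Matrix.mul_apply]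
  simp only [Nbig_mul_kron]

theorem Zblk_congr (K : ℂ → Matrix (Fin n) (Fin n) ℂ) (B : ℂ → Matrix (Fin n) (Fin m) ℂ)
    (N : Fin m → ℂ → Matrix (Fin n) (Fin n) ℂ) {s s' : ℕ → ℂ} (q : ℕ)
    (h : ∀ i ≤ q, s i = s' i) : Zblk K B N s q = Zblk K B N s' q := by
  induction q with
  | zero => rw [Zblk, Zblk, h 0 le_rfl]
  | succ q ih =>
    rw [Zblk, Zblk, ih fun i hi => h i (by omega), h _ le_rfl, h q (by omega)]

/-- Right-hand side of the linear system solved by the `t`-th Hermite state function. -/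
noncomputable def hermRhs (K : ℂ → Matrix (Fin n) (Fin n) ℂ) (B : ℂ → Matrix (Fin n) (Fin m) ℂ)
    (N : Fin m → ℂ → Matrix (Fin n) (Fin n) ℂ) (σ : ℕ → ℂ) (ℓ : ℕ → ℕ) (b : Fin m → ℂ) :
    (t : ℕ) → ℂ → Matrix (Fin n) (outT m t) ℂ
  | 0 => fun z => B z * bCol b
  | t + 1 => fun _ => hChainB K B N σ ℓ b t

theorem EntryAnalytic.hermRhs {K : ℂ → Matrix (Fin n) (Fin n) ℂ}
    {B : ℂ → Matrix (Fin n) (Fin m) ℂ} (N : Fin m → ℂ → Matrix (Fin n) (Fin n) ℂ)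
    {σ : ℕ → ℂ} (ℓ : ℕ → ℕ) (b : Fin m → ℂ) (t : ℕ) (hB : EntryAnalytic B (σ t)) :
    EntryAnalytic (hermRhs K B N σ ℓ b t) (σ t) := by
  cases t with
  | zero => exact hB.mul (EntryAnalytic.const _ _)
  | succ t => exact EntryAnalytic.const _ _

theorem vHermB_eq {K : ℂ → Matrix (Fin n) (Fin n) ℂ} (B : ℂ → Matrix (Fin n) (Fin m) ℂ)
    (N : Fin m → ℂ → Matrix (Fin n) (Fin n) ℂ) {σ : ℕ → ℂ} (ℓ : ℕ → ℕ) (b : Fin m → ℂ) (t j : ℕ)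
    (hK : EntryAnalytic K (σ t)) (hu : IsUnit (K (σ t)).det) :
    vHermB K B N σ ℓ b t j = mDeriv j (fun z => (K z)⁻¹ * hermRhs K B N σ ℓ b t z) (σ t) := by
  cases t with
  | zero => simp only [vHermB, hermRhs, Matrix.mul_assoc]; rfl
  | succ t => exact (mDeriv_mul_const (hK.inv hu) _ _).symm

theorem hChainB_apply {K : ℂ → Matrix (Fin n) (Fin n) ℂ} (B : ℂ → Matrix (Fin n) (Fin m) ℂ)
    {N : Fin m → ℂ → Matrix (Fin n) (Fin n) ℂ} {σ : ℕ → ℂ} (ℓ : ℕ → ℕ) (b : Fin m → ℂ) (t : ℕ)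
    (hK : EntryAnalytic K (σ t)) (hu : IsUnit (K (σ t)).det)
    (hN : ∀ i, EntryAnalytic (N i) (σ t)) (e : Fin n) (i : Fin m) (o : outT m t) :
    hChainB K B N σ ℓ b t e (i, o) =
      mDeriv (ℓ t) (fun z => N i z * ((K z)⁻¹ * hermRhs K B N σ ℓ b t z)) (σ t) e o := by
  cases t with
  | zero =>
    refine congrArg (fun f => iteratedDeriv (ℓ 0) f (σ 0)) ?_
    funext z
    refine (Nbig_mul_kron N z _ e i o).trans ?_
    rw [Matrix.mul_assoc (K z)⁻¹]
    rfl
  | succ t =>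
    have ha : EntryAnalytic
        (fun z => Nbig N z * ((1 : Matrix (Fin m) (Fin m) ℂ) ⊗ₖ (K z)⁻¹)) (σ (t + 1)) := by
      rintro a ⟨i, c⟩
      simp only [Nbig_mul_kron]
      exact (hN i).mul (hK.inv hu) a c
    rw [hChainB, ← mDeriv_mul_const ha]
    simp only [mDeriv, Matrix.of_apply, Matrix.mul_assoc, ← Matrix.mul_kronecker_mul,
      Matrix.one_mul, Nbig_mul_kron, hermRhs]

theorem sum_mixedD_Zblk_mul_tangMat {C : ℂ → Matrix (Fin p) (Fin n) ℂ}
    {K : ℂ → Matrix (Fin n) (Fin n) ℂ} {B : ℂ → Matrix (Fin n) (Fin m) ℂ}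
    {N : Fin m → ℂ → Matrix (Fin n) (Fin n) ℂ} {σ : ℕ → ℂ} {ℓ ord : ℕ → ℕ} (b : Fin m → ℂ) (q : ℕ)
    (hord : ∀ t < q, ord t = ℓ t) (hC : EntryAnalytic C (σ q))
    (hK : ∀ t ≤ q, EntryAnalytic K (σ t)) (hB : ∀ t ≤ q, EntryAnalytic B (σ t))
    (hN : ∀ t ≤ q, ∀ i, EntryAnalytic (N i) (σ t)) (hu : ∀ t ≤ q, IsUnit (K (σ t)).det)
    (a : Fin p) (o : outT m q) :
    ∑ cc, mixedD ord (q + 1) (fun s => (C (s q) * Zblk K B N s q) a cc) σ * tangMat b q cc o =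
      mDeriv (ord q) (fun z => C z * ((K z)⁻¹ * hermRhs K B N σ ℓ b q z)) (σ q) a o := by
  induction q generalizing C with
  | zero =>
    have hx : EntryAnalytic (fun z => C z * ((K z)⁻¹ * B z)) (σ 0) :=
      hC.mul (((hK 0 le_rfl).inv (hu 0 le_rfl)).mul (hB 0 le_rfl))
    have h := congrFun (congrFun (mDeriv_mul_const hx (bCol b) (ord 0)) a) o
    simp only [Matrix.mul_assoc] at h
    refine Eq.trans ?_ (h.trans Matrix.mul_apply).symm
    refine Finset.sum_congr rfl fun cc _ => ?_
    simp only [mixedD, iterate_pD, Zblk, Function.update_self]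
    rfl
  | succ q ih =>
    obtain ⟨i, o⟩ := o
    have hCK : EntryAnalytic (fun z => C z * (K z)⁻¹) (σ (q + 1)) :=
      hC.mul ((hK _ le_rfl).inv (hu _ le_rfl))
    set D := mDeriv (ord (q + 1)) (fun z => C z * (K z)⁻¹) (σ (q + 1)) with hD
    have key : ∀ (i' : Fin m) (cc : colT m q),
        mixedD ord (q + 1 + 1)
          (fun s => (C (s (q + 1)) * Zblk K B N s (q + 1)) a ((i', cc) : Fin m × colT m q)) σ =
        mixedD ord (q + 1) (fun s => (D * N i' (s q) * Zblk K B N s q) a cc) σ := by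
      intro i' cc
      rw [mixedD]
      refine mixedD_congr _ _ fun s hs => ?_
      rw [iterate_pD, hs (q + 1) le_rfl, hD, Matrix.mul_assoc, ← mDeriv_mul_const hCK]
      refine congrArg (fun f => iteratedDeriv _ f _) ?_
      funext z
      rw [Zblk, Zblk_congr K B N (s' := s) q
        fun i hi => Function.update_of_ne (by omega) _ _]
      rw [Function.update_self, Function.update_of_ne (by omega)]
      exact mul_Nbig_mul_kron N _ _ _ _ a i' cc
    have hDN : EntryAnalytic (fun z => D * N i z) (σ q) :=
      (EntryAnalytic.const D _).mul (hN q (by omega) i)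
    have hR : EntryAnalytic (hermRhs K B N σ ℓ b q) (σ q) :=
      EntryAnalytic.hermRhs N ℓ b q (hB q (by omega))
    have hX : EntryAnalytic (fun z => (K z)⁻¹ * hermRhs K B N σ ℓ b q z) (σ q) :=
      ((hK q (by omega)).inv (hu q (by omega))).mul hR
    have h := ih (fun t ht => hord t (by omega)) hDN (fun t ht => hK t (by omega))
      (fun t ht => hB t (by omega)) (fun t ht => hN t (by omega)) (fun t ht => hu t (by omega)) o
    have hl : ∑ cc, mixedD ord (q + 1 + 1)
        (fun s => (C (s (q + 1)) * Zblk K B N s (q + 1)) a cc) σ *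
          tangMat b (q + 1) cc ((i, o) : Fin m × outT m q) =
        ∑ cc, mixedD ord (q + 1) (fun s => (D * N i (s q) * Zblk K B N s q) a cc) σ *
          tangMat b q cc o := by
      refine (Fintype.sum_prod_type (f := fun cc : Fin m × colT m q => mixedD ord (q + 1 + 1)
        (fun s => (C (s (q + 1)) * Zblk K B N s (q + 1)) a cc) σ *
          tangMat b (q + 1) cc ((i, o) : Fin m × outT m q))).trans ?_
      simp only [key]
      simp [tangMat, Matrix.kroneckerMap_apply, Matrix.one_apply]
    refine hl.trans (h.trans ?_)
    simp only [Matrix.mul_assoc]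
    rw [mDeriv_const_mul ((hN q (by omega) i).mul hX)]
    have hr := congrFun (congrFun
      (mDeriv_mul_const hCK (hChainB K B N σ ℓ b q) (ord (q + 1))) a) ((i, o) : Fin m × outT m q)
    simp only [Matrix.mul_assoc] at hr
    refine Matrix.mul_apply.trans (Eq.trans ?_ (hr.trans Matrix.mul_apply).symm)
    refine Finset.sum_congr rfl fun e _ => ?_
    rw [hChainB_apply B ℓ b q (hK q (by omega)) (hu q (by omega)) (hN q (by omega)),
      hord q (by omega)]

end Blockwise

theorem stmt_11 {n m p r : ℕ} (hn : 0 < n) (hm : 0 < m) (hp : 0 < p) (hr : 0 < r)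
    (C : ℂ → Matrix (Fin p) (Fin n) ℂ) (K : ℂ → Matrix (Fin n) (Fin n) ℂ)
    (B : ℂ → Matrix (Fin n) (Fin m) ℂ) (N : Fin m → ℂ → Matrix (Fin n) (Fin n) ℂ)
    (V W : Matrix (Fin n) (Fin r) ℂ)
    (k : ℕ) (hk : 0 < k) (σ : ℕ → ℂ) (ℓ : ℕ → ℕ) (b : Fin m → ℂ)
    (hCa : ∀ j < k, ∀ a e, AnalyticAt ℂ (fun z => C z a e) (σ j))
    (hKa : ∀ j < k, ∀ a e, AnalyticAt ℂ (fun z => K z a e) (σ j))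
    (hBa : ∀ j < k, ∀ a e, AnalyticAt ℂ (fun z => B z a e) (σ j))
    (hNa : ∀ j < k, ∀ ι a e, AnalyticAt ℂ (fun z => N ι z a e) (σ j))
    (hK : ∀ j < k, IsUnit (K (σ j)).det)
    (hKr : ∀ j < k, IsUnit (Wᴴ * K (σ j) * V).det)
    (hV : ∀ t < k, ∀ j ≤ ℓ t, ∀ cix : outT m t,
      (fun i => vHermB K B N σ ℓ b t j i cix) ∈ Set.range V.mulVec) :
    ∀ q < k, ∀ jq ≤ ℓ q,
      (Matrix.of fun a cc =>
          mixedD (fun t => if t = q then jq else ℓ t) (q + 1)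
            (fun s => Gblk C K B N s q a cc) σ) *
          tangMat b q =
        (Matrix.of fun a cc =>
          mixedD (fun t => if t = q then jq else ℓ t) (q + 1)
            (fun s => Gblk (fun s => C s * V) (fun s => Wᴴ * K s * V) (fun s => Wᴴ * B s) (fun ι s => Wᴴ * N ι s * V) s q a cc) σ) *
          tangMat b q := by
  have hWa : ∀ z, EntryAnalytic (fun _ => Wᴴ) z := EntryAnalytic.const _
  have hVa : ∀ z, EntryAnalytic (fun _ => V) z := EntryAnalytic.const _
  have hKra : ∀ t < k, EntryAnalytic (fun s => Wᴴ * K s * V) (σ t) := fun t ht =>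
    ((hWa _).mul (hKa t ht)).mul (hVa _)
  have hBra : ∀ t < k, EntryAnalytic (fun s => Wᴴ * B s) (σ t) := fun t ht =>
    (hWa _).mul (hBa t ht)
  have hNra : ∀ t < k, ∀ i, EntryAnalytic (fun s => Wᴴ * N i s * V) (σ t) := fun t ht i =>
    ((hWa _).mul (hNa t ht i)).mul (hVa _)
  have hXa : ∀ t < k, EntryAnalytic (fun z => (K z)⁻¹ * hermRhs K B N σ ℓ b t z) (σ t) :=
    fun t ht => (EntryAnalytic.inv (hKa t ht) (hK t ht)).mul
      (EntryAnalytic.hermRhs N ℓ b t (hBa t ht))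
  have hXra : ∀ t < k, EntryAnalytic (fun z => (Wᴴ * K z * V)⁻¹ *
      hermRhs (fun s => Wᴴ * K s * V) (fun s => Wᴴ * B s) (fun i s => Wᴴ * N i s * V)
        σ ℓ b t z) (σ t) :=
    fun t ht => ((hKra t ht).inv (hKr t ht)).mul (EntryAnalytic.hermRhs _ ℓ b t (hBra t ht))
  have hproj : ∀ t < k,
      (∀ z, hermRhs (fun s => Wᴴ * K s * V) (fun s => Wᴴ * B s) (fun i s => Wᴴ * N i s * V)
        σ ℓ b t z = Wᴴ * hermRhs K B N σ ℓ b t z) →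
      JetEq (ℓ t) (fun z => (K z)⁻¹ * hermRhs K B N σ ℓ b t z)
        (fun z => V * ((Wᴴ * K z * V)⁻¹ *
          hermRhs (fun s => Wᴴ * K s * V) (fun s => Wᴴ * B s) (fun i s => Wᴴ * N i s * V)
            σ ℓ b t z)) (σ t) := by
    intro t ht hR
    simp only [hR]
    refine jetEq_projected (hKa t ht) (EntryAnalytic.hermRhs N ℓ b t (hBa t ht)) (hK t ht)
      (hKr t ht) fun j hj => ?_
    choose y hy using hV t ht j hj
    refine ⟨Matrix.of fun i c => y c i, ?_⟩
    rw [← vHermB_eq B N ℓ b t j (hKa t ht) (hK t ht)]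
    ext i c
    exact (congrFun (hy c) i).symm
  have hrhs : ∀ t < k, ∀ z,
      hermRhs (fun s => Wᴴ * K s * V) (fun s => Wᴴ * B s) (fun i s => Wᴴ * N i s * V)
        σ ℓ b t z = Wᴴ * hermRhs K B N σ ℓ b t z := by
    intro t
    induction t with
    | zero => intro _ z; exact Matrix.mul_assoc _ _ _
    | succ t ih =>
      intro ht z
      have ht' : t < k := by omega
      ext e ⟨i, o⟩
      have hjet := (hproj t ht' (ih ht')).mul_left ((hWa _).mul (hNa t ht' i)) (hXa t ht')
        ((hVa _).mul (hXra t ht'))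
      have h1 := hjet (ℓ t) le_rfl
      simp only [Matrix.mul_assoc] at h1
      rw [mDeriv_const_mul (EntryAnalytic.mul (hNa t ht' i) (hXa t ht'))] at h1
      have h2 := hChainB_apply (fun s => Wᴴ * B s) ℓ b t (hKra t ht') (hKr t ht') (hNra t ht') e i o
      simp only [Matrix.mul_assoc] at h2
      simp only [hermRhs, Matrix.mul_assoc]
      rw [h2]
      refine (congrFun (congrFun h1.symm e) o).trans
        (Matrix.mul_apply.trans (Eq.trans ?_ Matrix.mul_apply.symm))
      refine Finset.sum_congr rfl fun c _ => ?_
      rw [hChainB_apply B ℓ b t (hKa t ht') (hK t ht') (hNa t ht')]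
  intro q hq jq hjq
  ext a o
  have hord : ∀ t < q, (if t = q then jq else ℓ t) = ℓ t := fun t ht => if_neg (by omega)
  have h1 := sum_mixedD_Zblk_mul_tangMat (ord := fun t => if t = q then jq else ℓ t) b q hord
    (hCa q hq) (fun t ht => hKa t (by omega)) (fun t ht => hBa t (by omega))
    (fun t ht => hNa t (by omega)) (fun t ht => hK t (by omega)) a o
  have h2 := sum_mixedD_Zblk_mul_tangMat (ord := fun t => if t = q then jq else ℓ t) b q hord
    (EntryAnalytic.mul (hCa q hq) (hVa _)) (fun t ht => hKra t (by omega))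
    (fun t ht => hBra t (by omega)) (fun t ht => hNra t (by omega))
    (fun t ht => hKr t (by omega)) a o
  refine (Matrix.mul_apply.trans h1).trans (Eq.trans ?_ (Matrix.mul_apply.trans h2).symm)
  rw [if_pos rfl]
  have h3 := (hproj q hq (hrhs q hq)).mul_left (hCa q hq) (hXa q hq) ((hVa _).mul (hXra q hq)) jq hjq
  simp only [← Matrix.mul_assoc (C _) V] at h3
  exact congrFun (congrFun h3 a) o

end StructBilin
end
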